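/- Let T be a Hausdorff, uniquely arcwise connected topological space, and let (A_i)_{i ∈ ι} be a family of path-connected subsets of T. Then any two points of the intersection ⋂_i A_i are joined by a path lying inside ⋂_i A_i; that is, for all x, x' ∈ ⋂_i A_i one has JoinedIn (⋂_i A_i) x x'. -/

import Mathlib

/-- The endpoints of every gap of `F` have the same image under `γ`. -/
def CollapsesGaps {T : Type*} (γ : unitInterval → T) (F : Set unitInterval) : Prop :=
  ∀ a ∈ F, ∀ b ∈ F, a < b → (∀ z ∈ F, a < z → b ≤ z) → γ a = γ b

/-- The intersection of a chain of closed sets whose gaps are collapsed by `γ`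
has its gaps collapsed by `γ`. -/
theorem CollapsesGaps.sInter {T : Type*} [TopologicalSpace T] [T2Space T]
    {γ : unitInterval → T} (hγ : Continuous γ) {c : Set (Set unitInterval)}
    (hne : c.Nonempty) (hchain : IsChain (· ⊆ ·) c) (hclosed : ∀ G ∈ c, IsClosed G)
    (hc : ∀ G ∈ c, CollapsesGaps γ G) : CollapsesGaps γ (⋂₀ c) := by
  intro a ha b hb hab hgap
  by_contra hne'
  obtain ⟨U, V, hU, hV, haU, hbV, hUV⟩ := t2_separation hne'
  obtain ⟨m, ham, hmb⟩ := exists_between hab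
  obtain ⟨u, hau, hu⟩ := exists_Ico_subset_of_mem_nhds
    ((hU.preimage hγ).mem_nhds haU) ⟨b, hab⟩
  obtain ⟨v, hvb, hv⟩ := exists_Ioc_subset_of_mem_nhds
    ((hV.preimage hγ).mem_nhds hbV) ⟨a, hab⟩
  obtain ⟨u', hau', hu'⟩ := exists_between (lt_min hau ham)
  obtain ⟨v', hv', hvb'⟩ := exists_between (max_lt hvb hmb)
  rw [lt_min_iff] at hu'
  rw [max_lt_iff] at hv'
  have huv' : u' < v' := hu'.2.trans hv'.2
  have : Nonempty c := hne.to_subtype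
  obtain ⟨⟨G, hG⟩, hdisj⟩ := (isCompact_Icc (a := u') (b := v')).elim_directed_family_closed
    (fun G : c => (G : Set unitInterval)) (fun G => hclosed G G.2)
    (by
      rw [← Set.sInter_eq_iInter, Set.eq_empty_iff_forall_notMem]
      rintro z ⟨⟨hz1, hz2⟩, hz⟩
      exact absurd (hgap z hz (hau'.trans_le hz1)) (not_le.2 (hz2.trans_lt hvb')))
    (by
      rintro ⟨G, hG⟩ ⟨H, hH⟩
      rcases hchain.total hG hH with h | h
      · exact ⟨⟨G, hG⟩, subset_rfl, h⟩
      · exact ⟨⟨H, hH⟩, h, subset_rfl⟩)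
  obtain ⟨s, ⟨hsG, hsu⟩, hs⟩ := ((hclosed G hG).inter isClosed_Iic).isCompact.exists_isGreatest
    ⟨a, ha G hG, hau'.le⟩
  obtain ⟨t, ⟨htG, htv⟩, ht⟩ := ((hclosed G hG).inter isClosed_Ici).isCompact.exists_isLeast
    ⟨b, hb G hG, hvb'.le⟩
  have has : a ≤ s := hs ⟨ha G hG, hau'.le⟩
  have htb : t ≤ b := ht ⟨hb G hG, hvb'.le⟩
  have hst : γ s = γ t := by
    refine hc G hG s hsG t htG (hsu.trans_lt (huv'.trans_le htv)) fun z hz hsz => ?_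
    rcases le_or_gt z u' with h | h
    · exact absurd (hs ⟨hz, h⟩) (not_le.2 hsz)
    · rcases le_or_gt v' z with h' | h'
      · exact ht ⟨hz, h'⟩
      · exact absurd (show z ∈ Set.Icc u' v' ∩ G from ⟨⟨h.le, h'.le⟩, hz⟩)
          (by rw [hdisj]; exact Set.notMem_empty z)
  have hsU : γ s ∈ U := hu ⟨has, hsu.trans_lt hu'.1⟩
  have htV : γ t ∈ V := hv ⟨hv'.1.trans_le htv, htb⟩
  exact Set.disjoint_left.1 hUV hsU (hst ▸ htV)

/-- There is a closed set of parameters containing both endpoints on which a path takes equal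
values exactly at the endpoints of the gaps. -/
theorem exists_isClosed_eq_iff_gap {T : Type*} [TopologicalSpace T] [T2Space T]
    {γ : unitInterval → T} (hγ : Continuous γ) :
    ∃ F : Set unitInterval, IsClosed F ∧ 0 ∈ F ∧ 1 ∈ F ∧
      ∀ a ∈ F, ∀ b ∈ F, a < b → (γ a = γ b ↔ ∀ z ∈ F, a < z → b ≤ z) := by
  obtain ⟨F, -, ⟨hF, h0, h1, hgap⟩, hmin⟩ := zorn_superset_nonempty
    {F : Set unitInterval | IsClosed F ∧ 0 ∈ F ∧ 1 ∈ F ∧ CollapsesGaps γ F}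
    (fun c hc hchain hne => ⟨⋂₀ c,
      ⟨isClosed_sInter fun G hG => (hc hG).1, fun G hG => (hc hG).2.1,
        fun G hG => (hc hG).2.2.1, CollapsesGaps.sInter hγ hne hchain
          (fun G hG => (hc hG).1) fun G hG => (hc hG).2.2.2⟩,
      fun G hG => Set.sInter_subset_of_mem hG⟩)
    Set.univ
    ⟨isClosed_univ, trivial, trivial, fun a _ b _ hab h => by
      obtain ⟨z, haz, hzb⟩ := exists_between hab
      exact absurd (h z trivial haz) (not_le.2 hzb)⟩
  refine ⟨F, hF, h0, h1, fun a ha b hb hab => ⟨fun heq z hz haz => ?_, hgap a ha b hb hab⟩⟩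
  have hmem : F \ Set.Ioo a b ∈
      {F : Set unitInterval | IsClosed F ∧ 0 ∈ F ∧ 1 ∈ F ∧ CollapsesGaps γ F} := by
    refine ⟨hF.sdiff isOpen_Ioo, ⟨h0, fun h => not_lt.2 unitInterval.nonneg' h.1⟩,
      ⟨h1, fun h => not_lt.2 unitInterval.le_one' h.2⟩, fun s hs t ht hst h => ?_⟩
    by_cases hex : ∀ z ∈ F, s < z → t ≤ z
    · exact hgap s hs.1 t ht.1 hst hex
    push Not at hex
    obtain ⟨w, hw, hsw, hwt⟩ := hex
    have hwab : w ∈ Set.Ioo a b := by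
      by_contra hw'
      exact absurd (h w ⟨hw, hw'⟩ hsw) (not_le.2 hwt)
    have hsa : s ≤ a := by
      by_contra! h'
      exact hs.2 ⟨h', hsw.trans hwab.2⟩
    have hbt : b ≤ t := by
      by_contra! h'
      exact ht.2 ⟨hwab.1.trans hwt, h'⟩
    have hsa' : s = a := by
      refine hsa.antisymm (not_lt.1 fun h' => ?_)
      exact absurd (h a ⟨ha, fun h => h.1.false⟩ h') (not_le.2 (hab.trans_le hbt))
    have hbt' : t = b :=
      (h b ⟨hb, fun h => h.2.false⟩ (hsa.trans_lt hab)).antisymm hbt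
    rw [hsa', hbt', heq]
  by_contra! hzb
  exact (hmin hmem Set.sdiff_subset hz).2 ⟨haz, hzb⟩

/-- If distinct gaps of `F` have no common endpoint and `0`, `1` do not bound a common gap, then
there is a countable densely ordered subset of `F` without extremal elements, separating the points of `F`
that do not bound a common gap and containing no right endpoint of a gap. -/
theorem exists_countable_order_dense_subset {F : Set unitInterval} (h0 : 0 ∈ F) (h1 : 1 ∈ F)
    (hF : ∃ z ∈ F, 0 < z ∧ z < 1)
    (hiso : ∀ a ∈ F, ∀ b ∈ F, ∀ c ∈ F, a < b → b < c →
      (∃ z ∈ F, a < z ∧ z < b) ∨ ∃ z ∈ F, b < z ∧ z < c) :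
    ∃ D ⊆ F, D.Countable ∧ D.Nonempty ∧ (∀ d ∈ D, 0 < d) ∧
      (∀ d ∈ D, ∀ s ∈ F, s < d → ∃ d' ∈ D, s < d' ∧ d' < d) ∧
      (∀ d ∈ D, ∃ d' ∈ D, d < d') ∧
      ∀ s ∈ F, ∀ t ∈ F, (∃ z ∈ F, s < z ∧ z < t) →
        ∃ d ∈ D, ∃ d' ∈ D, s < d ∧ d < d' ∧ d' < t := by
  have between : ∀ s ∈ F, ∀ t ∈ F, (∃ z ∈ F, s < z ∧ z < t) →
      ∃ z ∈ F, (∃ w ∈ F, s < w ∧ w < z) ∧ ∃ w ∈ F, z < w ∧ w < t := by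
    rintro s hs t ht ⟨z, hz, hsz, hzt⟩
    rcases hiso s hs z hz t ht hsz hzt with ⟨y, hy, hsy, hyz⟩ | ⟨y, hy, hzy, hyt⟩
    · rcases hiso s hs y hy z hz hsy hyz with ⟨x, hx, hsx, hxy⟩ | ⟨x, hx, hyx, hxz⟩
      · exact ⟨y, hy, ⟨x, hx, hsx, hxy⟩, ⟨z, hz, hyz, hzt⟩⟩
      · exact ⟨x, hx, ⟨y, hy, hsy, hyx⟩, ⟨z, hz, hxz, hzt⟩⟩
    · rcases hiso z hz y hy t ht hzy hyt with ⟨x, hx, hzx, hxy⟩ | ⟨x, hx, hyx, hxt⟩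
      · exact ⟨x, hx, ⟨z, hz, hsz, hzx⟩, ⟨y, hy, hxy, hyt⟩⟩
      · exact ⟨y, hy, ⟨z, hz, hsz, hzy⟩, ⟨x, hx, hyx, hxt⟩⟩
  let L : Set unitInterval := {t ∈ F | ∀ s ∈ F, s < t → ∃ z ∈ F, s < z ∧ z < t}
  have hL : ∀ s ∈ F, ∀ t ∈ F, (∃ z ∈ F, s < z ∧ z < t) → ∃ z ∈ L, s < z ∧ z < t := by
    intro s hs t ht hst
    obtain ⟨z, hz, ⟨y, hy, hsy, hyz⟩, ⟨x, hx, hzx, hxt⟩⟩ := between s hs t ht hst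
    by_cases hzL : z ∈ L
    · exact ⟨z, hzL, hsy.trans hyz, hzx.trans hxt⟩
    have : ∃ w ∈ F, w < z ∧ ∀ v ∈ F, w < v → z ≤ v := by
      by_contra! hcon
      exact hzL ⟨hz, hcon⟩
    obtain ⟨w, hw, hwz, hgap⟩ := this
    have hyw : y ≤ w := by
      by_contra! h
      exact absurd (hgap y hy h) (not_le.2 hyz)
    refine ⟨w, ⟨hw, fun u hu huw => ?_⟩, hsy.trans_le hyw, hwz.trans (hzx.trans hxt)⟩
    rcases hiso u hu w hw z hz huw hwz with h | ⟨v, hv, hwv, hvz⟩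
    · exact h
    · exact absurd (hgap v hv hwv) (not_le.2 hvz)
  obtain ⟨D, hDL, hDc, hD⟩ :=
    (TopologicalSpace.IsSeparable.of_separableSpace L).exists_countable_dense_subset
  have hDF : ∀ d ∈ D, d ∈ F := fun d hd => (hDL hd).1
  have key : ∀ s ∈ F, ∀ t ∈ F, (∃ z ∈ F, s < z ∧ z < t) →
      ∃ d ∈ D, s < d ∧ ∃ z ∈ F, d < z ∧ z < t := by
    intro s hs t ht hst
    obtain ⟨z, hz, hsz, hzt⟩ := between s hs t ht hst
    obtain ⟨l, hl, hsl, hlz⟩ := hL s hs z hz hsz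
    obtain ⟨d, hd, hdD⟩ := mem_closure_iff.1 (hD hl) (Set.Ioo s z) isOpen_Ioo ⟨hsl, hlz⟩
    obtain ⟨w, hw, hzw, hwt⟩ := hzt
    exact ⟨d, hdD, hd.1, z, hz, hd.2, hzw.trans hwt⟩
  let E : Set unitInterval := {d ∈ D | 0 < d ∧ ∃ z ∈ F, d < z ∧ z < 1}
  have key' : ∀ s ∈ F, ∀ t ∈ F, (∃ z ∈ F, s < z ∧ z < t) →
      ∃ d ∈ E, s < d ∧ ∃ z ∈ F, d < z ∧ z < t := by
    intro s hs t ht hst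
    obtain ⟨d, hd, hsd, z, hz, hdz, hzt⟩ := key s hs t ht hst
    exact ⟨d, ⟨hd, unitInterval.nonneg'.trans_lt hsd, z, hz, hdz, hzt.trans_le unitInterval.le_one'⟩, hsd, z, hz, hdz, hzt⟩
  refine ⟨E, fun d hd => hDF d hd.1, hDc.mono (Set.sep_subset _ _), ?_, fun d hd => hd.2.1, ?_, ?_, ?_⟩
  · obtain ⟨d, hd, -⟩ := key' 0 h0 1 h1 hF
    exact ⟨d, hd⟩
  · intro d hd s hs hsd
    obtain ⟨d', hd', hsd', z, -, hdz, hzd⟩ := key' s hs d (hDF d hd.1) ((hDL hd.1).2 s hs hsd)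
    exact ⟨d', hd', hsd', hdz.trans hzd⟩
  · intro d hd
    obtain ⟨d', hd', hdd', -⟩ := key' d (hDF d hd.1) 1 h1 hd.2.2
    exact ⟨d', hd', hdd'⟩
  · intro s hs t ht hst
    obtain ⟨d, hd, hsd, hdt⟩ := key' s hs t ht hst
    obtain ⟨d', hd', hdd', z, -, hdz, hzt⟩ := key' d (hDF d hd.1) t ht hdt
    exact ⟨d, hd, d', hd', hsd, hdd', hdz.trans hzt⟩

/-- A closed set containing `0` and `1`, distinct gaps of which have no common endpoint, admits
a continuous monotone map onto the unit interval identifying exactly the endpoints of its gaps. -/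
theorem exists_continuous_monotone_eq_iff_gap {F : Set unitInterval} (hFc : IsClosed F)
    (h0 : 0 ∈ F) (h1 : 1 ∈ F) (hF : ∃ z ∈ F, 0 < z ∧ z < 1)
    (hiso : ∀ a ∈ F, ∀ b ∈ F, ∀ c ∈ F, a < b → b < c →
      (∃ z ∈ F, a < z ∧ z < b) ∨ ∃ z ∈ F, b < z ∧ z < c) :
    ∃ φ : unitInterval → unitInterval, Continuous φ ∧ Monotone φ ∧ φ '' F = Set.univ ∧
      ∀ a ∈ F, ∀ b ∈ F, a < b → (φ a = φ b ↔ ∀ z ∈ F, a < z → b ≤ z) := by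
  obtain ⟨D, hDF, hDc, hDne, hD0, hDmin, hDmax, hDsep⟩ :=
    exists_countable_order_dense_subset h0 h1 hF hiso
  obtain ⟨E, hEc, hEd, hEbot, hEtop⟩ := exists_countable_dense_no_bot_top unitInterval
  have : Countable D := hDc.to_subtype
  have : Countable E := hEc.to_subtype
  have : Nonempty D := hDne.to_subtype
  have : DenselyOrdered D := ⟨fun a b hab => by
    obtain ⟨d, hd, h⟩ := hDmin b b.2 a (hDF a.2) hab
    exact ⟨⟨d, hd⟩, h⟩⟩
  have : NoMinOrder D := ⟨fun a => by
    obtain ⟨d, hd, h⟩ := hDmin a a.2 0 h0 (hD0 a a.2)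
    exact ⟨⟨d, hd⟩, h.2⟩⟩
  have : NoMaxOrder D := ⟨fun a => by
    obtain ⟨d, hd, h⟩ := hDmax a a.2
    exact ⟨⟨d, hd⟩, h⟩⟩
  have hE0 : ∀ e : E, (0 : unitInterval) < e := fun e =>
    lt_of_le_of_ne unitInterval.nonneg' fun h =>
      hEbot e (fun x => h ▸ unitInterval.nonneg') e.2
  have hE1 : ∀ e : E, (e : unitInterval) < 1 := fun e =>
    lt_of_le_of_ne unitInterval.le_one' fun h =>
      hEtop e (fun x => h ▸ unitInterval.le_one') e.2
  have : Nonempty E := hEd.nonempty.to_subtype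
  have : DenselyOrdered E := ⟨fun a b hab => by
    obtain ⟨d, hd, h⟩ := hEd.exists_between (show (a : unitInterval) < b from hab)
    exact ⟨⟨d, hd⟩, h⟩⟩
  have : NoMinOrder E := ⟨fun a => by
    obtain ⟨d, hd, h⟩ := hEd.exists_between (hE0 a)
    exact ⟨⟨d, hd⟩, h.2⟩⟩
  have : NoMaxOrder E := ⟨fun a => by
    obtain ⟨d, hd, h⟩ := hEd.exists_between (hE1 a)
    exact ⟨⟨d, hd⟩, h.1⟩⟩
  obtain ⟨e⟩ := Order.iso_of_countable_dense D E
  let φ : unitInterval → unitInterval := fun t =>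
    ⨆ d : {d : D // (d : unitInterval) ≤ t}, (e d : unitInterval)
  have hφmono : Monotone φ := fun s t hst =>
    iSup_le fun d => le_iSup (fun d : {d : D // (d : unitInterval) ≤ t} => (e d : unitInterval))
      ⟨d, d.2.trans hst⟩
  have hle : ∀ (d : D) (t : unitInterval), (d : unitInterval) ≤ t → (e d : unitInterval) ≤ φ t :=
    fun d t h => le_iSup (fun d : {d : D // (d : unitInterval) ≤ t} => (e d : unitInterval)) ⟨d, h⟩
  have hge : ∀ (d : D) (t : unitInterval), t ≤ d → φ t ≤ e d := fun d t h =>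
    iSup_le fun d' => e.monotone (show (d' : D) ≤ d from d'.2.trans h)
  have hφD : ∀ d : D, φ d = e d := fun d => (hge d d le_rfl).antisymm (hle d d le_rfl)
  have hdense : Dense (φ '' F) := hEd.mono fun x hx =>
    ⟨e.symm ⟨x, hx⟩, hDF (e.symm ⟨x, hx⟩).2, by rw [hφD, e.apply_symm_apply]⟩
  have hφ : Continuous φ :=
    hφmono.continuous_of_denseRange (hdense.mono (Set.image_subset_range _ _))
  refine ⟨φ, hφ, hφmono, ?_, fun a ha b hb hab => ⟨fun h => ?_, fun h => ?_⟩⟩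
  · exact (hFc.isCompact.image hφ).isClosed.closure_eq ▸ hdense.closure_eq
  · by_contra! hcon
    obtain ⟨d, hd, d', hd', had, hdd', hdb⟩ := hDsep a ha b hb hcon
    have h' : (e ⟨d, hd⟩ : unitInterval) < e ⟨d', hd'⟩ :=
      e.strictMono (show (⟨d, hd⟩ : D) < ⟨d', hd'⟩ from hdd')
    exact absurd h ((hge ⟨d, hd⟩ a had.le).trans_lt (h'.trans_le (hle ⟨d', hd'⟩ b hdb.le))).ne
  · refine (hφmono hab.le).antisymm (iSup_le fun d => hle d a ?_)
    by_contra! had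
    obtain ⟨d', hd', had', hdd'⟩ := hDmin d d.1.2 a ha had
    exact absurd (h d' (hDF hd') had') (not_le.2 (hdd'.trans_le d.2))

/-- In a Hausdorff space, the image of a path with distinct endpoints contains an arc
joining these endpoints. -/
theorem exists_injective_path_range_subset {T : Type*} [TopologicalSpace T] [T2Space T]
    {γ : unitInterval → T} (hγ : Continuous γ) (hne : γ 0 ≠ γ 1) :
    ∃ q : unitInterval → T, Continuous q ∧ Function.Injective q ∧ q 0 = γ 0 ∧ q 1 = γ 1 ∧
      Set.range q ⊆ Set.range γ := by
  obtain ⟨F, hFc, h0, h1, hF⟩ := exists_isClosed_eq_iff_gap hγ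
  have hnt : ∃ z ∈ F, 0 < z ∧ z < 1 := by
    by_contra! hcon
    exact hne ((hF 0 h0 1 h1 zero_lt_one).2 hcon)
  have hiso : ∀ a ∈ F, ∀ b ∈ F, ∀ c ∈ F, a < b → b < c →
      (∃ z ∈ F, a < z ∧ z < b) ∨ ∃ z ∈ F, b < z ∧ z < c := by
    intro a ha b hb c hc hab hbc
    by_contra! hcon
    have h := ((hF a ha b hb hab).2 hcon.1).trans ((hF b hb c hc hbc).2 hcon.2)
    exact absurd ((hF a ha c hc (hab.trans hbc)).1 h b hb hab) (not_le.2 hbc)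
  obtain ⟨φ, hφ, hφmono, hsurj, hφF⟩ := exists_continuous_monotone_eq_iff_gap hFc h0 h1 hnt hiso
  have hiff : ∀ a ∈ F, ∀ b ∈ F, (φ a = φ b ↔ γ a = γ b) := by
    intro a ha b hb
    rcases lt_trichotomy a b with h | h | h
    · rw [hφF a ha b hb h, hF a ha b hb h]
    · simp [h]
    · rw [eq_comm, hφF b hb a ha h, ← hF b hb a ha h, eq_comm]
  have hex : ∀ r, ∃ t ∈ F, φ t = r := fun r => by
    have : r ∈ φ '' F := hsurj ▸ Set.mem_univ r
    exact this
  choose ψ hψF hψ using hex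
  have : CompactSpace F := isCompact_iff_compactSpace.1 hFc.isCompact
  have hφF' : Continuous fun t : F => φ t := hφ.comp continuous_subtype_val
  have hquot : Topology.IsQuotientMap fun t : F => φ t :=
    hφF'.isClosedMap.isQuotientMap hφF' fun r => ⟨⟨ψ r, hψF r⟩, hψ r⟩
  have hqφ : ∀ t ∈ F, γ (ψ (φ t)) = γ t := fun t ht => (hiff _ (hψF _) _ ht).1 (hψ _)
  have hφ0 : φ 0 = 0 :=
    ((hφmono unitInterval.nonneg').trans (hψ 0).le).antisymm unitInterval.nonneg'
  have hφ1 : φ 1 = 1 :=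
    unitInterval.le_one'.antisymm ((hψ 1).ge.trans (hφmono unitInterval.le_one'))
  refine ⟨γ ∘ ψ, hquot.continuous_iff.2 ?_, fun r s h => ?_, ?_, ?_,
    Set.range_comp_subset_range _ _⟩
  · have : (γ ∘ ψ) ∘ (fun t : F => φ t) = fun t : F => γ t := funext fun t => hqφ t t.2
    rw [this]
    exact hγ.comp continuous_subtype_val
  · rw [← hψ r, ← hψ s]
    exact (hiff _ (hψF r) _ (hψF s)).2 h
  · simpa [hφ0] using hqφ 0 h0
  · simpa [hφ1] using hqφ 1 h1

/-- In a Hausdorff, uniquely arcwise connected space `T`, any two points of an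
intersection of path-connected subsets are joined by a path inside the intersection. -/
theorem joinedIn_iInter_of_pathConnected
    {T : Type*} [TopologicalSpace T] [T2Space T] {ι : Type*}
    (harc : ∀ x y : T, x ≠ y → ∃ p : unitInterval → T,
      Continuous p ∧ Function.Injective p ∧ p 0 = x ∧ p 1 = y)
    (huniq : ∀ (x y : T) (p q : unitInterval → T),
      Continuous p → Function.Injective p → p 0 = x → p 1 = y →
      Continuous q → Function.Injective q → q 0 = x → q 1 = y →
      Set.range p = Set.range q)
    (A : ι → Set T) (hA : ∀ i, IsPathConnected (A i))
    (x x' : T) (hx : x ∈ ⋂ i, A i) (hx' : x' ∈ ⋂ i, A i) :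
    JoinedIn (⋂ i, A i) x x' := by
  rcases eq_or_ne x x' with rfl | hne
  · exact JoinedIn.refl hx
  obtain ⟨p, hp, hpinj, hp0, hp1⟩ := harc x x' hne
  refine ⟨⟨⟨p, hp⟩, hp0, hp1⟩, fun t => Set.mem_iInter.2 fun i => ?_⟩
  obtain ⟨γ, hγ⟩ := (hA i).joinedIn x (Set.mem_iInter.1 hx i) x' (Set.mem_iInter.1 hx' i)
  obtain ⟨q, hq, hqinj, hq0, hq1, hqγ⟩ :=
    exists_injective_path_range_subset γ.continuous (by simpa using hne)
  have hpq := huniq x x' p q hp hpinj hp0 hp1 hq hqinj (by simpa using hq0) (by simpa using hq1)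
  obtain ⟨s, hs⟩ := hqγ (hpq ▸ Set.mem_range_self t)
  exact (show p t ∈ A i from hs ▸ hγ s)
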